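/- arXiv:1908.08342 — 3 statements merged into one kernel-verified Lean document; each statement's English description precedes it below -/
import Mathlib

section
/- Let (X, d) be a pseudometric space, T : X → X a γ-contraction with γ ∈ [0, 1), and x* ∈ X a point with d(T x*, x*) = 0. Suppose (x_k)_{k ∈ ℕ} is a sequence in X of approximate iterates satisfying d(x_{k+1}, T x_k) ≤ ε for all k, for some ε ≥ 0. Then limsup_{k → ∞} d(x_k, x*) ≤ ε / (1 − γ). -/
/-- A discrete Gronwall bound for the affine recursion `a (k + 1) ≤ γ * a k + ε`. -/
theorem le_div_one_sub_add_pow_mul {a : ℕ → ℝ} {γ ε : ℝ} (hγ0 : 0 ≤ γ) (hγ1 : γ < 1)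
    (ha : ∀ k, a (k + 1) ≤ γ * a k + ε) (k : ℕ) :
    a k ≤ ε / (1 - γ) + γ ^ k * (a 0 - ε / (1 - γ)) := by
  induction k with
  | zero => simp
  | succ k ih =>
    have hfix : γ * (ε / (1 - γ)) + ε = ε / (1 - γ) := by
      have : 1 - γ ≠ 0 := (sub_pos.mpr hγ1).ne'
      field_simp
      ring
    calc a (k + 1) ≤ γ * a k + ε := ha k
      _ ≤ γ * (ε / (1 - γ) + γ ^ k * (a 0 - ε / (1 - γ))) + ε := by gcongr
      _ = (γ * (ε / (1 - γ)) + ε) + γ ^ (k + 1) * (a 0 - ε / (1 - γ)) := by ring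
      _ = ε / (1 - γ) + γ ^ (k + 1) * (a 0 - ε / (1 - γ)) := by rw [hfix]

/-- A nonnegative sequence with `a (k + 1) ≤ γ * a k + ε` and `γ ∈ [0, 1)` has limit superior
at most `ε / (1 - γ)`. -/
theorem limsup_le_div_one_sub {a : ℕ → ℝ} {γ ε : ℝ} (hγ0 : 0 ≤ γ) (hγ1 : γ < 1)
    (ha0 : ∀ k, 0 ≤ a k) (ha : ∀ k, a (k + 1) ≤ γ * a k + ε) :
    Filter.limsup a Filter.atTop ≤ ε / (1 - γ) := by
  have hlim : Filter.Tendsto (fun k : ℕ => ε / (1 - γ) + γ ^ k * (a 0 - ε / (1 - γ)))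
      Filter.atTop (nhds (ε / (1 - γ))) := by
    simpa using ((tendsto_pow_atTop_nhds_zero_of_lt_one hγ0 hγ1).mul_const
      (a 0 - ε / (1 - γ))).const_add (ε / (1 - γ))
  rw [← hlim.limsup_eq]
  exact Filter.limsup_le_limsup
    (Filter.Eventually.of_forall (le_div_one_sub_add_pow_mul hγ0 hγ1 ha))
    (Filter.isBoundedUnder_of ⟨0, ha0⟩ : Filter.IsBoundedUnder (· ≥ ·) _ a).isCoboundedUnder_le
    hlim.isBoundedUnder_le

/-- In a pseudometric space `(X, d)`, let `T` be a `γ`-contraction with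
`γ ∈ [0, 1)` and `x*` a point with `d(T x*, x*) = 0`. If `(x_k)` is a sequence of approximate
iterates with `d(x_{k+1}, T x_k) ≤ ε` for all `k` (for some `ε ≥ 0`), then
`limsup_{k → ∞} d(x_k, x*) ≤ ε / (1 - γ)`. -/
theorem pseudometric_contraction_approx_iterates_limsup {X : Type*}
    (d : X → X → ℝ) (T : X → X) (γ : ℝ)
    (hrefl : ∀ x, d x x = 0)
    (hnonneg : ∀ x y, 0 ≤ d x y)
    (hsymm : ∀ x y, d x y = d y x)
    (htri : ∀ x y z, d x z ≤ d x y + d y z)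
    (hγ0 : 0 ≤ γ) (hγ1 : γ < 1)
    (hT : ∀ x y, d (T x) (T y) ≤ γ * d x y)
    (xs : X) (hxs : d (T xs) xs = 0)
    (ε : ℝ) (hε : 0 ≤ ε)
    (x : ℕ → X) (hx : ∀ k : ℕ, d (x (k + 1)) (T (x k)) ≤ ε) :
    Filter.limsup (fun k => d (x k) xs) Filter.atTop ≤ ε / (1 - γ) := by
  refine limsup_le_div_one_sub hγ0 hγ1 (fun k => hnonneg (x k) xs) fun k => ?_
  have h₁ := htri (x (k + 1)) (T (x k)) xs
  have h₂ := htri (T (x k)) (T xs) xs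
  linarith [hx k, hT (x k) xs]
end

section
/- (Multi-objective evaluation operator is a contraction.) Let S and A be nonempty finite types, m ≥ 1, r : S → A → (Fin m → ℝ) a vector reward function, P : S → A → PMF S a transition kernel, π : S → PMF A a stationary stochastic policy, γ ∈ [0, 1), and Ω a nonempty finite set of vectors in Fin m → ℝ. Define the evaluation operator T_π on functions Q : S → A → Ω → (Fin m → ℝ) by (T_π Q)(s, a, ω) = r s a + γ · ∑_{s' ∈ S} (P s a) s' · ∑_{a' ∈ A} (π s') a' · Q s' a' ω, where arithmetic on vectors is componentwise. Then for the pseudometric d(Q, Q') := max over (s, a, ω ∈ Ω) of |⟨ω, Q s a ω − Q' s a ω⟩| (with ⟨·,·⟩ the standard dot product on Fin m → ℝ), one has d(T_π Q, T_π Q') ≤ γ · d(Q, Q') for all Q, Q'. -/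
/-- Standard dot product on `Fin m → ℝ`. -/
def dotp {m : ℕ} (u v : Fin m → ℝ) : ℝ := ∑ i, u i * v i

/-- The value pseudometric `d(Q, Q') = max_{s, a, ω ∈ Ω} |⟨ω, Q s a ω - Q' s a ω⟩|` on
multi-objective Q-value functions. -/
def mdist {S A : Type*} [Fintype S] [Fintype A] [Nonempty S] [Nonempty A] {m : ℕ}
    (Ω : Finset (Fin m → ℝ)) (hΩ : Ω.Nonempty)
    (Q Q' : S → A → (Fin m → ℝ) → (Fin m → ℝ)) : ℝ :=
  (Finset.univ ×ˢ Finset.univ ×ˢ Ω).sup'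
    (Finset.univ_nonempty.product (Finset.univ_nonempty.product hΩ))
    fun p : S × A × (Fin m → ℝ) =>
      |dotp p.2.2 (Q p.1 p.2.1 p.2.2 - Q' p.1 p.2.1 p.2.2)|

theorem PMF.sum_toReal_eq_one {α : Type*} [Fintype α] (p : PMF α) :
    ∑ a, (p a).toReal = 1 := by
  rw [← ENNReal.toReal_sum fun a _ => p.apply_ne_top a, (tsum_fintype p).symm.trans p.tsum_coe,
    ENNReal.toReal_one]

/-- An average against a probability mass function is bounded by any uniform bound. -/
theorem PMF.abs_sum_toReal_mul_le {α : Type*} [Fintype α] (p : PMF α) {f : α → ℝ} {M : ℝ}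
    (hf : ∀ a, |f a| ≤ M) : |∑ a, (p a).toReal * f a| ≤ M :=
  calc |∑ a, (p a).toReal * f a| ≤ ∑ a, |(p a).toReal * f a| :=
        Finset.abs_sum_le_sum_abs _ _
    _ ≤ ∑ a, (p a).toReal * M := by
        gcongr with a
        rw [abs_mul, abs_of_nonneg ENNReal.toReal_nonneg]
        exact mul_le_mul_of_nonneg_left (hf a) ENNReal.toReal_nonneg
    _ = M := by rw [← Finset.sum_mul, p.sum_toReal_eq_one, one_mul]

theorem dotp_eq_dotProduct {m : ℕ} (u v : Fin m → ℝ) : dotp u v = u ⬝ᵥ v := rfl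

theorem abs_dotp_sub_le_mdist {S A : Type*} [Fintype S] [Fintype A] [Nonempty S] [Nonempty A]
    {m : ℕ} (Ω : Finset (Fin m → ℝ)) (hΩ : Ω.Nonempty)
    (Q Q' : S → A → (Fin m → ℝ) → (Fin m → ℝ)) (s : S) (a : A) {ω : Fin m → ℝ} (hω : ω ∈ Ω) :
    |dotp ω (Q s a ω - Q' s a ω)| ≤ mdist Ω hΩ Q Q' :=
  Finset.le_sup' (fun p : S × A × (Fin m → ℝ) =>
    |dotp p.2.2 (Q p.1 p.2.1 p.2.2 - Q' p.1 p.2.1 p.2.2)|)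
    (b := (s, a, ω)) (by simp [hω])

/-- Multi-objective evaluation operator is a contraction: with
`(T_π Q)(s, a, ω) = r s a + γ · ∑_{s'} P(s'|s,a) · ∑_{a'} π(a'|s') · Q s' a' ω`
(componentwise vector arithmetic) and the pseudometric
`d(Q, Q') = max_{s, a, ω ∈ Ω} |⟨ω, Q s a ω - Q' s a ω⟩|`, we have
`d(T_π Q, T_π Q') ≤ γ · d(Q, Q')`. -/
theorem multiobjective_evaluation_operator_contraction
    {S A : Type*} [Fintype S] [Fintype A] [Nonempty S] [Nonempty A]
    {m : ℕ} (hm : 1 ≤ m)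
    (r : S → A → (Fin m → ℝ)) (P : S → A → PMF S) (π : S → PMF A)
    (γ : ℝ) (hγ0 : 0 ≤ γ) (hγ1 : γ < 1)
    (Ω : Finset (Fin m → ℝ)) (hΩ : Ω.Nonempty)
    (Tπ : (S → A → (Fin m → ℝ) → (Fin m → ℝ)) → (S → A → (Fin m → ℝ) → (Fin m → ℝ)))
    (hTπ : ∀ (Q : S → A → (Fin m → ℝ) → (Fin m → ℝ)) (s : S) (a : A) (ω : Fin m → ℝ),
      Tπ Q s a ω = r s a + γ • ∑ s' : S, ((P s a) s').toReal •
        ∑ a' : A, ((π s') a').toReal • Q s' a' ω)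
    (Q Q' : S → A → (Fin m → ℝ) → (Fin m → ℝ)) :
    mdist Ω hΩ (Tπ Q) (Tπ Q') ≤ γ * mdist Ω hΩ Q Q' := by
  refine Finset.sup'_le _ _ ?_
  rintro ⟨s, a, ω⟩ hp
  have hω : ω ∈ Ω := by simpa using hp
  have key : dotp ω (Tπ Q s a ω - Tπ Q' s a ω) = γ * ∑ s' : S, ((P s a) s').toReal *
      ∑ a' : A, ((π s') a').toReal * dotp ω (Q s' a' ω - Q' s' a' ω) := by
    simp only [hTπ, dotp_eq_dotProduct, add_sub_add_left_eq_sub, dotProduct_sub,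
      dotProduct_smul, dotProduct_sum, smul_eq_mul, mul_sub, Finset.sum_sub_distrib]
  change |dotp ω (Tπ Q s a ω - Tπ Q' s a ω)| ≤ _
  rw [key, abs_mul, abs_of_nonneg hγ0]
  refine mul_le_mul_of_nonneg_left ?_ hγ0
  exact (P s a).abs_sum_toReal_mul_le fun s' => (π s').abs_sum_toReal_mul_le fun a' =>
    abs_dotp_sub_le_mdist Ω hΩ Q Q' s' a' hω
end

section
/- (Completeness of the multi-objective value space.) Let S and A be nonempty finite types, m ≥ 1, and let Ω be a nonempty subset of the probability simplex {ω : Fin m → ℝ | (∀ i, 0 ≤ ω i) ∧ ∑_i ω i = 1}. Let 𝒬 be the set of bounded functions Q : S → A → Ω → (Fin m → ℝ) (bounded meaning sup over s, a, ω, i of |Q s a ω i| is finite), and define d(Q, Q') := sup over s ∈ S, a ∈ A, ω ∈ Ω of |⟨ω, Q s a ω − Q' s a ω⟩|. Then: (i) d is a pseudometric on 𝒬, i.e., d(Q,Q) = 0, d(Q,Q') = d(Q',Q), and d(Q,Q'') ≤ d(Q,Q') + d(Q',Q'') for all Q, Q', Q'' ∈ 𝒬; and (ii) (𝒬, d) is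 complete: every sequence (Q_n) in 𝒬 that is Cauchy with respect to d has a limit Q_∞ ∈ 𝒬 with d(Q_n, Q_∞) → 0. -/
/-- A multi-objective Q-value function is bounded (over preferences in `Ω`). -/
def mbdd {S A : Type*} {m : ℕ} (Ω : Set (Fin m → ℝ))
    (Q : S → A → (Fin m → ℝ) → (Fin m → ℝ)) : Prop :=
  ∃ C : ℝ, ∀ (s : S) (a : A), ∀ ω ∈ Ω, ∀ i : Fin m, |Q s a ω i| ≤ C

/-- The value pseudometric
`d(Q, Q') = sup_{s ∈ S, a ∈ A, ω ∈ Ω} |⟨ω, Q s a ω - Q' s a ω⟩|`. -/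
noncomputable def vdist {S A : Type*} {m : ℕ} (Ω : Set (Fin m → ℝ))
    (Q Q' : S → A → (Fin m → ℝ) → (Fin m → ℝ)) : ℝ :=
  ⨆ p : S × A × Ω,
    |dotp (p.2.2 : Fin m → ℝ) (Q p.1 p.2.1 (p.2.2 : Fin m → ℝ) - Q' p.1 p.2.1 (p.2.2 : Fin m → ℝ))|

theorem dotp_sub {m : ℕ} (u v w : Fin m → ℝ) : dotp u (v - w) = dotp u v - dotp u w := by
  simp [dotp, mul_sub, Finset.sum_sub_distrib]

theorem dotp_const {m : ℕ} {ω : Fin m → ℝ} (hω : ω ∈ stdSimplex ℝ (Fin m)) (c : ℝ) :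
    dotp ω (fun _ => c) = c := by
  simp [dotp, ← Finset.sum_mul, hω.2]

theorem abs_dotp_le {m : ℕ} {ω : Fin m → ℝ} (hω : ω ∈ stdSimplex ℝ (Fin m)) {v : Fin m → ℝ}
    {C : ℝ} (hv : ∀ i, |v i| ≤ C) : |dotp ω v| ≤ C :=
  calc |dotp ω v| ≤ ∑ i, |ω i * v i| := Finset.abs_sum_le_sum_abs _ _
    _ ≤ ∑ i, ω i * C := Finset.sum_le_sum fun i _ => by
        rw [abs_mul, abs_of_nonneg (hω.1 i)]
        exact mul_le_mul_of_nonneg_left (hv i) (hω.1 i)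
    _ = C := dotp_const hω C

section vdist

variable {S A : Type*} {m : ℕ} {Ω : Set (Fin m → ℝ)}
  {Q Q' : S → A → (Fin m → ℝ) → (Fin m → ℝ)}

theorem abs_dotp_sub_le_vdist (hΩ : Ω ⊆ stdSimplex ℝ (Fin m)) (hQ : mbdd Ω Q) (hQ' : mbdd Ω Q')
    (s : S) (a : A) {ω : Fin m → ℝ} (hω : ω ∈ Ω) :
    |dotp ω (Q s a ω) - dotp ω (Q' s a ω)| ≤ vdist Ω Q Q' := by
  obtain ⟨C, hC⟩ := hQ
  obtain ⟨C', hC'⟩ := hQ'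
  rw [← dotp_sub]
  refine le_ciSup (f := fun p : S × A × Ω =>
    |dotp (p.2.2 : Fin m → ℝ) (Q p.1 p.2.1 p.2.2 - Q' p.1 p.2.1 p.2.2)|) ?_ (s, a, ⟨ω, hω⟩)
  refine ⟨C + C', ?_⟩
  rintro _ ⟨⟨t, b, η, hη⟩, rfl⟩
  exact abs_dotp_le (hΩ hη) fun i =>
    (abs_sub _ _).trans (add_le_add (hC t b η hη i) (hC' t b η hη i))

theorem vdist_le {r : ℝ} (hr : 0 ≤ r)
    (h : ∀ s a, ∀ ω ∈ Ω, |dotp ω (Q s a ω) - dotp ω (Q' s a ω)| ≤ r) : vdist Ω Q Q' ≤ r :=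
  Real.iSup_le (fun p => by
    rw [dotp_sub]
    exact h p.1 p.2.1 p.2.2 p.2.2.2) hr

theorem vdist_nonneg : 0 ≤ vdist Ω Q Q' :=
  Real.iSup_nonneg fun _ => abs_nonneg _

theorem vdist_self : vdist Ω Q Q = 0 :=
  le_antisymm (vdist_le le_rfl (by simp)) vdist_nonneg

theorem vdist_comm : vdist Ω Q Q' = vdist Ω Q' Q := by
  simp only [vdist, dotp_sub, abs_sub_comm]

theorem vdist_triangle {Q'' : S → A → (Fin m → ℝ) → (Fin m → ℝ)}
    (hΩ : Ω ⊆ stdSimplex ℝ (Fin m)) (hQ : mbdd Ω Q) (hQ' : mbdd Ω Q') (hQ'' : mbdd Ω Q'') :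
    vdist Ω Q Q'' ≤ vdist Ω Q Q' + vdist Ω Q' Q'' :=
  vdist_le (add_nonneg vdist_nonneg vdist_nonneg) fun s a _ hω =>
    (abs_sub_le _ _ _).trans (add_le_add (abs_dotp_sub_le_vdist hΩ hQ hQ' s a hω)
      (abs_dotp_sub_le_vdist hΩ hQ' hQ'' s a hω))

/-- The limit is the vector all of whose coordinates equal the limit of the scalarized values; a
weight in the simplex scalarizes it to that same limit. -/
theorem exists_tendsto_vdist_of_cauchy (hΩ : Ω ⊆ stdSimplex ℝ (Fin m))
    {Qn : ℕ → S → A → (Fin m → ℝ) → (Fin m → ℝ)} (hQn : ∀ n, mbdd Ω (Qn n))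
    (hcauchy : ∀ ε > (0 : ℝ), ∃ N : ℕ, ∀ ℓ ≥ N, ∀ k ≥ N, vdist Ω (Qn ℓ) (Qn k) ≤ ε) :
    ∃ Qinf : S → A → (Fin m → ℝ) → (Fin m → ℝ), mbdd Ω Qinf ∧
      Filter.Tendsto (fun n => vdist Ω (Qn n) Qinf) Filter.atTop (nhds 0) := by
  have hlim : ∀ s a ω, ∃ c : ℝ, ω ∈ Ω →
      Filter.Tendsto (fun n => dotp ω (Qn n s a ω)) Filter.atTop (nhds c) := by
    intro s a ω
    by_cases hω : ω ∈ Ω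
    · have hseq : CauchySeq fun n => dotp ω (Qn n s a ω) := by
        refine Metric.cauchySeq_iff.2 fun ε hε => ?_
        obtain ⟨N, hN⟩ := hcauchy (ε / 2) (half_pos hε)
        exact ⟨N, fun ℓ hℓ k hk => ((abs_dotp_sub_le_vdist hΩ (hQn ℓ) (hQn k) s a hω).trans
          (hN ℓ hℓ k hk)).trans_lt (half_lt_self hε)⟩
      obtain ⟨c, hc⟩ := cauchySeq_tendsto_of_complete hseq
      exact ⟨c, fun _ => hc⟩
    · exact ⟨0, fun h => absurd h hω⟩
  choose c hc using hlim
  have hunif : ∀ ε > (0 : ℝ), ∃ N : ℕ, ∀ n ≥ N, ∀ s a, ∀ ω ∈ Ω,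
      |dotp ω (Qn n s a ω) - c s a ω| ≤ ε := by
    intro ε hε
    obtain ⟨N, hN⟩ := hcauchy ε hε
    refine ⟨N, fun n hn s a ω hω => ?_⟩
    refine le_of_tendsto ((hc s a ω hω).const_sub _).abs ?_
    filter_upwards [Filter.eventually_ge_atTop N] with k hk
    exact (abs_dotp_sub_le_vdist hΩ (hQn n) (hQn k) s a hω).trans (hN n hn k hk)
  refine ⟨fun s a ω _ => c s a ω, ?_, ?_⟩
  · obtain ⟨N, hN⟩ := hunif 1 one_pos
    obtain ⟨C, hC⟩ := hQn N
    refine ⟨C + 1, fun s a ω hω _ => ?_⟩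
    have h₁ := abs_le.1 (hN N le_rfl s a ω hω)
    have h₂ := abs_le.1 (abs_dotp_le (hΩ hω) (hC s a ω hω))
    exact abs_le.2 ⟨by linarith, by linarith⟩
  · refine Metric.tendsto_atTop.2 fun ε hε => ?_
    obtain ⟨N, hN⟩ := hunif (ε / 2) (half_pos hε)
    refine ⟨N, fun n hn => ?_⟩
    rw [Real.dist_0_eq_abs, abs_of_nonneg vdist_nonneg]
    refine (vdist_le (half_pos hε).le fun s a ω hω => ?_).trans_lt (half_lt_self hε)
    rw [dotp_const (hΩ hω)]
    exact hN n hn s a ω hω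

end vdist

/-- Completeness of the multi-objective value space: for `Ω` a nonempty subset
of the probability simplex and `𝒬` the set of bounded multi-objective Q-value functions with
`d(Q, Q') = sup_{s, a, ω ∈ Ω} |⟨ω, Q s a ω - Q' s a ω⟩|`:
(i) `d` is a pseudometric on `𝒬` (reflexivity, symmetry, triangle inequality), and
(ii) `(𝒬, d)` is complete: every `d`-Cauchy sequence in `𝒬` has a limit in `𝒬`. -/
theorem multiobjective_value_space_complete_pseudometric
    {S A : Type*} [Fintype S] [Fintype A] [Nonempty S] [Nonempty A]
    {m : ℕ} (hm : 1 ≤ m)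
    (Ω : Set (Fin m → ℝ)) (hΩne : Ω.Nonempty)
    (hΩ : Ω ⊆ {ω : Fin m → ℝ | (∀ i, 0 ≤ ω i) ∧ ∑ i, ω i = 1}) :
    (∀ Q : S → A → (Fin m → ℝ) → (Fin m → ℝ), mbdd Ω Q → vdist Ω Q Q = 0) ∧
    (∀ Q Q' : S → A → (Fin m → ℝ) → (Fin m → ℝ), mbdd Ω Q → mbdd Ω Q' →
      vdist Ω Q Q' = vdist Ω Q' Q) ∧
    (∀ Q Q' Q'' : S → A → (Fin m → ℝ) → (Fin m → ℝ),
      mbdd Ω Q → mbdd Ω Q' → mbdd Ω Q'' →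
      vdist Ω Q Q'' ≤ vdist Ω Q Q' + vdist Ω Q' Q'') ∧
    (∀ Qn : ℕ → (S → A → (Fin m → ℝ) → (Fin m → ℝ)), (∀ n, mbdd Ω (Qn n)) →
      (∀ ε > (0 : ℝ), ∃ N : ℕ, ∀ ℓ ≥ N, ∀ k ≥ N, vdist Ω (Qn ℓ) (Qn k) ≤ ε) →
      ∃ Qinf : S → A → (Fin m → ℝ) → (Fin m → ℝ), mbdd Ω Qinf ∧
        Filter.Tendsto (fun n => vdist Ω (Qn n) Qinf) Filter.atTop (nhds 0)) := by
  exact ⟨fun _ _ => vdist_self, fun _ _ _ _ => vdist_comm,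
    fun _ _ _ hQ hQ' hQ'' => vdist_triangle hΩ hQ hQ' hQ'',
    fun _ hQn hcauchy => exists_tendsto_vdist_of_cauchy hΩ hQn hcauchy⟩
end
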